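/- Fix a prime p and a natural number k. Let σ = {(i,j) ∈ ℕ × ℕ | i + j ≤ k}, let R = MvPolynomial σ ℕ, and let A_k = RingQuot r be the quotient commutative ℕ-semiring by the relation r generated by X_{(i,j)}^p ∼ X_{(i+1,j)} + p·X_{(i,j+1)} for all (i,j) with i + j ≤ k − 1. Then the ℕ-algebra homomorphism from MvPolynomial (Fin (k+1)) ℕ to A_k sending the i-th variable to the image of X_{(i, k−i)} is injective; that is, the images of the k+1 diagonal variables X_{(i,k−i)} (0 ≤ i ≤ k) generate a free polynomial sub-ℕ-algebra of A_k on k+1 generators. -/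

import Mathlib

open MvPolynomial

/-- The defining relations `X_{(i,j)}^p = X_{(i+1,j)} + p·X_{(i,j+1)}` (for `i + j ≤ k − 1`)
on the polynomial semiring over `ℕ` in the variables `X_{(i,j)}`, `i + j ≤ k`. -/
inductive WittSemiringRel (p k : ℕ) :
    MvPolynomial {q : ℕ × ℕ // q.1 + q.2 ≤ k} ℕ →
      MvPolynomial {q : ℕ × ℕ // q.1 + q.2 ≤ k} ℕ → Prop
  | mk (i j : ℕ) (h : i + j < k) :
      WittSemiringRel p k
        (X (⟨(i, j), by omega⟩ : {q : ℕ × ℕ // q.1 + q.2 ≤ k}) ^ p)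
        (X (⟨(i + 1, j), by omega⟩ : {q : ℕ × ℕ // q.1 + q.2 ≤ k}) +
          (p : MvPolynomial {q : ℕ × ℕ // q.1 + q.2 ≤ k} ℕ) *
            X (⟨(i, j + 1), by omega⟩ : {q : ℕ × ℕ // q.1 + q.2 ≤ k}))

/-- Over an algebraically closed field, the relations `X_{(i,j)}^p = X_{(i+1,j)} + p·X_{(i,j+1)}`
can be solved with arbitrary prescribed values on the diagonal `i + j = k`. -/
theorem WittSemiringRel.exists_ringHom_diagonal_eq {K : Type*} [Field K] [IsAlgClosed K]
    {p : ℕ} (hp : 0 < p) (k : ℕ) (t : ℕ → K) :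
    ∃ φ : RingQuot (WittSemiringRel p k) →+* K, ∀ (i : ℕ) (hi : i ≤ k),
      φ (RingQuot.mkRingHom (WittSemiringRel p k)
        (X (⟨(i, k - i), by omega⟩ : {q : ℕ × ℕ // q.1 + q.2 ≤ k}))) = t i := by
  choose root hroot using fun a : K => IsAlgClosed.exists_pow_nat_eq a hp
  let y : ℕ → ℕ → K := fun n =>
    Nat.rec t (fun _ z i => root (z (i + 1) + (p : K) * z i)) n
  let f : MvPolynomial {q : ℕ × ℕ // q.1 + q.2 ≤ k} ℕ →+* K :=
    eval₂Hom (Nat.castRingHom K) fun q => y (k - (q.1.1 + q.1.2)) q.1.1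
  have hf : ∀ ⦃a b⦄, WittSemiringRel p k a b → f a = f b := by
    rintro _ _ ⟨i, j, h⟩
    obtain ⟨n, rfl⟩ : ∃ n, k = i + j + n + 1 := ⟨k - (i + j) - 1, by omega⟩
    have h₀ : i + j + n + 1 - (i + j) = n + 1 := by omega
    have h₁ : i + j + n + 1 - (i + 1 + j) = n := by omega
    have h₂ : i + j + n + 1 - (i + (j + 1)) = n := by omega
    simp only [map_pow, map_add, map_mul, map_natCast, f, coe_eval₂Hom, eval₂_X, h₀, h₁, h₂]
    exact hroot _
  refine ⟨RingQuot.lift ⟨f, hf⟩, fun i hi => ?_⟩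
  have h : k - (i + (k - i)) = 0 := by omega
  simp only [RingQuot.lift_mkRingHom_apply, f, coe_eval₂Hom, eval₂_X, h]
  rfl

/-- In the quotient semiring `A_k`, the images of the `k+1` diagonal variables
`X_{(i, k−i)}` generate a free polynomial sub-`ℕ`-algebra on `k+1` generators. -/
theorem wittSemiring_diagonal_injective (p k : ℕ) (hp : p.Prime) :
    Function.Injective
      (MvPolynomial.aeval
        (fun i : Fin (k + 1) =>
          RingQuot.mkRingHom (WittSemiringRel p k)
            (X (⟨(i.1, k - i.1), by have := i.isLt; omega⟩ :
              {q : ℕ × ℕ // q.1 + q.2 ≤ k}))) :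
        MvPolynomial (Fin (k + 1)) ℕ →ₐ[ℕ] RingQuot (WittSemiringRel p k)) := by
  let F := FractionRing (MvPolynomial (Fin (k + 1)) ℤ)
  let ι : MvPolynomial (Fin (k + 1)) ℤ →+* AlgebraicClosure F :=
    (algebraMap F (AlgebraicClosure F)).comp (algebraMap _ F)
  have hι : Function.Injective ι :=
    (algebraMap F (AlgebraicClosure F)).injective.comp (IsFractionRing.injective _ F)
  obtain ⟨φ, hφ⟩ := WittSemiringRel.exists_ringHom_diagonal_eq hp.pos k
    (fun i => ι (X (Fin.ofNat (k + 1) i)))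
  have hcomp : φ.comp (RingHomClass.toRingHom (MvPolynomial.aeval
        (fun i : Fin (k + 1) =>
          RingQuot.mkRingHom (WittSemiringRel p k)
            (X (⟨(i.1, k - i.1), by have := i.isLt; omega⟩ :
              {q : ℕ × ℕ // q.1 + q.2 ≤ k}))) :
        MvPolynomial (Fin (k + 1)) ℕ →ₐ[ℕ] RingQuot (WittSemiringRel p k))) =
      ι.comp (MvPolynomial.map (Nat.castRingHom ℤ)) := by
    refine MvPolynomial.ringHom_ext (fun n => ?_) (fun i => ?_)
    · simp
    · simp [hφ i.1 (Nat.le_of_lt_succ i.isLt)]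
  have hinj : Function.Injective (ι.comp (MvPolynomial.map (Nat.castRingHom ℤ))) :=
    hι.comp (MvPolynomial.map_injective _ Nat.cast_injective)
  rw [← hcomp] at hinj
  exact Function.Injective.of_comp (f := φ) hinj
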